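/- arXiv:2507.12102 — 3 statements merged into one kernel-verified Lean document; each statement's English description precedes it below -/
import Mathlib

section
/- Let k, n ≥ 1 and let φ be a CNF formula with clauses C₁,…,C_n over propositional variables p₁,…,p_k, where each clause C_i is a set of literals and a literal is a pair (j, b) ∈ {1,…,k} × {⊤,⊥} standing for p_j if b = ⊤ and for ¬p_j if b = ⊥. Define the NFA 𝒜_φ over the alphabet {⊤,⊥} × {1,…,k} with states {s₀, s₁, …, s_n}, initial state s₀, accepting state s_n, and a transition (s_{i−1}, (b, j), s_i) exactly when (j, b) ∈ C_i; regard 𝒜_φ as the underlying NFA of an NAA A_φ over Σ = {⊤,⊥} with directions {1,…,k}. Let W = {σ^i : σ ∈ {⊤,⊥}, 1 ≤ i ≤ n} be the set of constant words over {⊤,⊥} of length at most n. Then the match set M(A_φ, W) is nonempty if and only if φ is satisfiable, i.e., there exists an assignment v : {1,…,k} → {⊤,⊥} such that for every i ∈ {1,…,n} there is a literal (j, b) ∈ C_i with v(j) = b. -/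
open scoped BigOperators

/-- Projection of a word over the product alphabet onto direction `l`. -/
def proj {α κ : Type*} [DecidableEq κ] (l : κ) (w : List (α × κ)) : List α :=
  (w.filter fun p => decide (p.2 = l)).map Prod.fst

/-- `subword w i j` is the subword `w[i..j]` (1-based, inclusive; empty if `j < i`). -/
def subword {α : Type*} (w : List α) (i j : ℕ) : List α :=
  (w.drop (i - 1)).take (j + 1 - i)

/-- NAA acceptance of a `k`-tuple of words. -/
def NAAaccepts {α St : Type*} {k : ℕ} (A : NFA (α × Fin k) St) (u : Fin k → List α) : Prop :=
  ∃ what ∈ A.accepts, ∀ l : Fin k, proj l what = u l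

/-- Membership in the match set `M(A, W)`. -/
def MatchSet {α St : Type*} {k : ℕ} (A : NFA (α × Fin k) St) (W : Set (List α))
    (ws : Fin k → List α) (istart jend : Fin k → ℕ) : Prop :=
  (∀ l : Fin k, ws l ∈ W) ∧ NAAaccepts A (fun l => subword (ws l) (istart l) (jend l))

/-- The NFA `𝒜_φ` built from a CNF formula with clauses `C 0, …, C (n-1)` over `k`
propositional variables: states `s₀,…,s_n` (as `Fin (n+1)`), initial state `s₀`,
accepting state `s_n`, and a transition `(s_{i−1}, (b, j), s_i)` exactly when the
literal `(j, b)` belongs to the `i`-th clause. Letters `⊤`/`⊥` are `true`/`false`. -/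
def cnfNFA (k n : ℕ) (C : Fin n → Set (Fin k × Bool)) : NFA (Bool × Fin k) (Fin (n + 1)) where
  step s x := {t | ∃ h : (s : ℕ) < n, (t : ℕ) = (s : ℕ) + 1 ∧ (x.2, x.1) ∈ C ⟨s, h⟩}
  start := {⟨0, Nat.succ_pos n⟩}
  accept := {⟨n, Nat.lt_succ_self n⟩}

theorem mem_proj_iff {α κ : Type*} [DecidableEq κ] {l : κ} {w : List (α × κ)} {a : α} :
    a ∈ proj l w ↔ (a, l) ∈ w := by
  simp [proj]

theorem length_proj_le {α κ : Type*} [DecidableEq κ] (l : κ) (w : List (α × κ)) :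
    (proj l w).length ≤ w.length := by
  simpa [proj] using List.length_filter_le _ w

theorem mem_of_mem_subword {α : Type*} {w : List α} {i j : ℕ} {a : α}
    (h : a ∈ subword w i j) : a ∈ w :=
  List.mem_of_mem_drop (List.mem_of_mem_take h)

theorem subword_replicate_one {α : Type*} (a : α) {m n : ℕ} (h : m ≤ n) :
    subword (List.replicate n a) 1 m = List.replicate m a := by
  simp [subword, h]

theorem mem_cnfNFA_eval_iff {k n : ℕ} (C : Fin n → Set (Fin k × Bool))
    (w : List (Bool × Fin k)) (t : Fin (n + 1)) :
    t ∈ (cnfNFA k n C).eval w ↔ (t : ℕ) = w.length ∧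
      ∀ (i : ℕ) (h : i < w.length), ∃ h' : i < n, (w[i].2, w[i].1) ∈ C ⟨i, h'⟩ := by
  induction w using List.reverseRecOn generalizing t with
  | nil =>
    rw [NFA.eval_nil]
    change t = ⟨0, n.succ_pos⟩ ↔ _
    exact ⟨fun h => ⟨congrArg Fin.val h, fun i hi => absurd hi (Nat.not_lt_zero i)⟩,
      fun h => Fin.ext h.1⟩
  | append_singleton w x ih =>
    rw [NFA.eval_append_singleton, NFA.mem_stepSet]
    constructor
    · rintro ⟨s, hs, hlt, ht, hx⟩
      obtain ⟨hlen, hw⟩ := (ih s).1 hs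
      refine ⟨by simp [ht, hlen], fun i hi => ?_⟩
      rcases Nat.lt_or_ge i w.length with h | h
      · rw [List.getElem_append_left h]
        exact hw i h
      · obtain rfl : i = w.length := by simp at hi; omega
        simp only [hlen] at hlt hx
        exact ⟨hlt, by simpa using hx⟩
    · rintro ⟨ht, hw⟩
      obtain ⟨hlt, hx⟩ := hw w.length (by simp)
      refine ⟨⟨w.length, by omega⟩, (ih _).2 ⟨rfl, fun i hi => ?_⟩, hlt, by simpa using ht,
        by simpa using hx⟩
      have hi' : i < (w ++ [x]).length := by simp; omega
      have hwi := hw i hi'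
      rwa [List.getElem_append_left hi] at hwi

theorem mem_cnfNFA_accepts_iff {k n : ℕ} (C : Fin n → Set (Fin k × Bool))
    (w : List (Bool × Fin k)) :
    w ∈ (cnfNFA k n C).accepts ↔ w.length = n ∧
      ∀ (i : ℕ) (h : i < w.length), ∃ h' : i < n, (w[i].2, w[i].1) ∈ C ⟨i, h'⟩ := by
  have h : w ∈ (cnfNFA k n C).accepts ↔
      (⟨n, Nat.lt_succ_self n⟩ : Fin (n + 1)) ∈ (cnfNFA k n C).eval w := by
    change (∃ s ∈ ({⟨n, Nat.lt_succ_self n⟩} : Set (Fin (n + 1))), _) ↔ _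
    simp
  rw [h, mem_cnfNFA_eval_iff]
  simp only [eq_comm]

/-- With `W` the set of constant words `σ^i` (`σ ∈ {⊤,⊥}`, `1 ≤ i ≤ n`), the match set
`M(A_φ, W)` is nonempty iff the CNF formula `φ` is satisfiable. -/
theorem cnf_matchSet_nonempty_iff_satisfiable {k n : ℕ} (hk : 1 ≤ k) (hn : 1 ≤ n)
    (C : Fin n → Set (Fin k × Bool)) :
    (∃ ws istart jend,
        MatchSet (cnfNFA k n C)
          {w : List Bool | ∃ (σ : Bool) (i : ℕ), 1 ≤ i ∧ i ≤ n ∧ w = List.replicate i σ}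
          ws istart jend) ↔
      ∃ v : Fin k → Bool, ∀ i : Fin n, ∃ jb ∈ C i, v jb.1 = jb.2 := by
  constructor
  · rintro ⟨ws, istart, jend, hW, w, hw, hproj⟩
    obtain ⟨hlen, hC⟩ := (mem_cnfNFA_accepts_iff C w).1 hw
    choose v m _ _ hws using hW
    refine ⟨v, fun i => ?_⟩
    have hi : (i : ℕ) < w.length := hlen ▸ i.isLt
    obtain ⟨_, hmem⟩ := hC i hi
    refine ⟨_, hmem, ?_⟩
    have hb : w[(i : ℕ)].1 ∈ proj w[(i : ℕ)].2 w := mem_proj_iff.2 (List.getElem_mem hi)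
    rw [hproj] at hb
    have hb' := mem_of_mem_subword hb
    rw [hws] at hb'
    exact (List.eq_of_mem_replicate hb').symm
  · rintro ⟨v, hv⟩
    choose jb hjb hval using hv
    set w := List.ofFn fun i => ((jb i).2, (jb i).1) with hw
    have hlen : w.length = n := by simp [hw]
    refine ⟨fun l => List.replicate n (v l), fun _ => 1, fun l => (proj l w).length,
      fun l => ⟨v l, n, hn, le_rfl, rfl⟩, w, ?_, fun l => ?_⟩
    · refine (mem_cnfNFA_accepts_iff C w).2 ⟨hlen, fun i hi => ⟨hlen ▸ hi, ?_⟩⟩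
      simpa [hw] using hjb ⟨i, hlen ▸ hi⟩
    · refine Eq.trans ?_ (subword_replicate_one _ ((length_proj_le l w).trans_eq hlen)).symm
      refine List.eq_replicate_of_mem fun b hb => ?_
      obtain ⟨i, hi⟩ := (List.mem_ofFn' _ _).1 (mem_proj_iff.1 hb)
      obtain ⟨rfl, rfl⟩ := Prod.mk.inj hi
      exact (hval i).symm
end

section
/- Correctness of QS-style skipping: Let W ⊆ Σ* be a finite set of words, K = {1,…,k}, and let A be an NAA over Σ with directions K whose underlying NFA 𝒜 satisfies L(𝒜) ≠ ∅. For any w ∈ W, any m ∈ {1,…,k}, any i ∈ {1,…,|w| − SM_m}, and any match ((w₁,i¹,j¹),…,(w_k,i^k,j^k)) ∈ M(A, W), if SM_m > 0, the letter w[i + SM_m − 1] does not belong to LastQS_m, and w_m = w, then either i^m < i or i^m ≥ i + Δ_QS^m(w[i + SM_m]). -/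
open scoped BigOperators

/-- `SM`: the length of a shortest word accepted by the underlying NFA. -/
noncomputable def SM {α κ St : Type*} (A : NFA (α × κ) St) : ℕ :=
  sInf {n | ∃ what ∈ A.accepts, what.length = n}

/-- `SM_m`: the minimum number of direction-`m` letters among the first `SM` letters
of an accepted word. -/
noncomputable def SMdir {α κ St : Type*} [DecidableEq κ] (A : NFA (α × κ) St) (m : κ) : ℕ :=
  sInf {n | ∃ what ∈ A.accepts, (proj m (what.take (SM A))).length = n}

/-- `LastQS_m`: the set of `SM_m`-th letters of the words in `π_m(L(𝒜))` having at
least `SM_m` letters. -/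
def LastQS {α κ St : Type*} [DecidableEq κ] (A : NFA (α × κ) St) (m : κ) : Set α :=
  {a | ∃ what ∈ A.accepts, (proj m what)[SMdir A m - 1]? = some a}

/-- The QS-style skip value `Δ_QS^m(a)`. -/
noncomputable def ΔQS {α κ St : Type*} [DecidableEq κ] (A : NFA (α × κ) St) (m : κ)
    (a : α) : ℕ :=
  sInf ({SMdir A m + 1} ∪
    {i | 1 ≤ i ∧ i ≤ SMdir A m ∧
      ∃ what ∈ A.accepts, (proj m what)[SMdir A m - i]? = some a})

theorem SMdir_le_length_proj {α κ St : Type*} [DecidableEq κ] (A : NFA (α × κ) St) (m : κ)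
    {v : List (α × κ)} (hv : v ∈ A.accepts) : SMdir A m ≤ (proj m v).length := by
  have h : SMdir A m ≤ (proj m (v.take (SM A))).length := Nat.sInf_le ⟨v, hv, rfl⟩
  exact h.trans (((List.take_sublist _ _).filter _).map _).length_le

theorem getElem?_subword {α : Type*} {w : List α} {i j n : ℕ}
    (hn : n < (subword w i j).length) : (subword w i j)[n]? = w[i - 1 + n]? := by
  unfold subword at *
  rw [List.length_take] at hn
  rw [List.getElem?_take_of_lt (by omega), List.getElem?_drop]

/-- Correctness of QS-style skipping: if the `(i + SM_m − 1)`-th letter `a` of `w`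
is not in `LastQS_m` and `w_m = w`, then any match starts in direction `m` before `i`
or at least `Δ_QS^m` positions after `i`, where the skip value is taken at the
`(i + SM_m)`-th letter `a'` of `w`. -/
theorem qs_skipping_correct {Alph St : Type*} [Fintype Alph] [Fintype St] {k : ℕ}
    (A : NFA (Alph × Fin k) St) (hA : ∃ what, what ∈ A.accepts)
    (W : Set (List Alph)) (hW : W.Finite)
    (w : List Alph) (hw : w ∈ W) (m : Fin k)
    (i : ℕ) (hi1 : 1 ≤ i) (hi2 : i ≤ w.length - SMdir A m)
    (ws : Fin k → List Alph) (istart jend : Fin k → ℕ)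
    (hM : MatchSet A W ws istart jend)
    (hSM : 0 < SMdir A m)
    (a : Alph) (ha : w[i + SMdir A m - 2]? = some a) (haQS : a ∉ LastQS A m)
    (hwm : ws m = w)
    (a' : Alph) (ha' : w[i + SMdir A m - 1]? = some a') :
    istart m < i ∨ i + ΔQS A m a' ≤ istart m := by
  obtain ⟨-, v, hv, hproj⟩ := hM
  by_contra! hcon
  obtain ⟨hle, hlt⟩ := hcon
  have hv_eq : proj m v = subword w (istart m) (jend m) := hwm ▸ hproj m
  have hlen := SMdir_le_length_proj A m hv
  have hget : ∀ n < SMdir A m, (proj m v)[n]? = w[istart m - 1 + n]? := by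
    intro n hn
    have h : n < (proj m v).length := by omega
    rw [hv_eq] at h ⊢
    exact getElem?_subword h
  rcases hle.eq_or_lt with heq | hgt
  · refine haQS ⟨v, hv, ?_⟩
    rw [hget _ (by omega), ← ha]
    congr 1
    omega
  · have hmax : ΔQS A m a' ≤ SMdir A m + 1 := Nat.sInf_le (Or.inl rfl)
    have hmin : ΔQS A m a' ≤ istart m - i := by
      refine Nat.sInf_le (Or.inr ⟨by omega, by omega, v, hv, ?_⟩)
      rw [hget _ (by omega), ← ha']
      congr 1
      omega
    omega
end

section
/- Correctness of KMP-style skipping: Let W ⊆ Σ* be a finite set of words, K = {1,…,k}, and let A be an NAA over Σ with directions K, with underlying NFA 𝒜 with state set S. For any m ∈ {1,…,k}, any w ∈ W, any i ∈ {1,…,|w|}, any j ≥ i, and any state s ∈ S^m_{w[i..j]} for which Δ_KMP^m(s) is defined, there is no match ((w₁,i¹,j¹),…,(w_k,i^k,j^k)) ∈ M(A, W) with w_m = w and i^m ∈ {i + 1, i + 2, …, i + Δ_KMP^m(s) − 1}. -/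
/-- Projection of a language over `α × κ` onto direction `m`. -/
def projLang {α κ : Type*} [DecidableEq κ] (m : κ) (L : Language (α × κ)) : Language α :=
  (proj m) '' L

/-- `𝒜_s`: the NFA `A` with accepting set `{s}`. -/
def singleAccept {α St : Type*} (A : NFA α St) (s : St) : NFA α St :=
  { A with accept := {s} }

/-- The full language `Σ*`. -/
def fullLang (α : Type*) : Language α := Set.univ

/-- The language `Σⁿ` of all words of length `n`. -/
def lenLang (α : Type*) (n : ℕ) : Language α := {w | w.length = n}

/-- The set of positive `n` with
`(π_m(L(𝒜_s)) · Σ*) ∩ (Σⁿ · π_m(L(𝒜)) · Σ*) ≠ ∅`; `Δ_KMP^m(s)` is its minimum. -/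
def KMPset {α κ St : Type*} [DecidableEq κ] (A : NFA (α × κ) St) (m : κ) (s : St) :
    Set ℕ :=
  {n | 1 ≤ n ∧
    ∃ u, u ∈ projLang m (singleAccept A s).accepts * fullLang α ∧
      u ∈ lenLang α n * projLang m A.accepts * fullLang α}

/-- The KMP-style skip value `Δ_KMP^m(s)` (defined whenever `KMPset A m s` is
nonempty). -/
noncomputable def ΔKMP {α κ St : Type*} [DecidableEq κ] (A : NFA (α × κ) St) (m : κ)
    (s : St) : ℕ :=
  sInf (KMPset A m s)

/-- `S^m_u`: the set of states `s` such that `u ∈ π_m(L(𝒜_s))`. -/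
def reachStates {α κ St : Type*} [DecidableEq κ] (A : NFA (α × κ) St) (m : κ)
    (u : List α) : Set St :=
  {s | u ∈ projLang m (singleAccept A s).accepts}

/-- If a run reading `w[i..j]` in direction `m` ends in `s` and some accepted word reads
`w[i'..j']` in direction `m`, then the shift `i' - i` belongs to `KMPset A m s`. The letter `a`
pads `w` when the shift leaves the word. -/
theorem sub_mem_KMPset {α κ St : Type*} [DecidableEq κ] {A : NFA (α × κ) St} {m : κ} {s : St}
    {w : List α} {i j i' j' : ℕ} (hi : 1 ≤ i) (hii' : i < i') (a : α)
    (hs : s ∈ reachStates A m (subword w i j))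
    (hacc : subword w i' j' ∈ projLang m A.accepts) :
    i' - i ∈ KMPset A m s := by
  set n := i' - i with hn
  set u := w.drop (i - 1) ++ List.replicate n a with hu
  refine ⟨by omega, u, ?_, ?_⟩
  · refine Language.mem_mul.2 ⟨_, hs, (w.drop (i - 1)).drop (j + 1 - i) ++ List.replicate n a,
      Set.mem_univ _, ?_⟩
    rw [subword, ← List.append_assoc, List.take_append_drop]
  · have hdrop : u.drop n = w.drop (i' - 1) ++
        (List.replicate n a).drop (n - (w.drop (i - 1)).length) := by
      rw [hu, List.drop_append, List.drop_drop]
      congr 2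
      omega
    refine Language.mem_mul.2 ⟨_, Language.mem_mul.2 ⟨u.take n, ?_, _, hacc, rfl⟩,
      (w.drop (i' - 1)).drop (j' + 1 - i') ++
        (List.replicate n a).drop (n - (w.drop (i - 1)).length), Set.mem_univ _, ?_⟩
    · change (u.take n).length = n
      simp [hu]
    · rw [subword, List.append_assoc, ← List.append_assoc (List.take (j' + 1 - i') _),
        List.take_append_drop,
        ← hdrop, List.take_append_drop]

/-- Correctness of KMP-style skipping: for `w ∈ W`, `1 ≤ i ≤ |w|`, `j ≥ i`, and
`s ∈ S^m_{w[i..j]}` with `Δ_KMP^m(s)` defined, there is no match whose `m`-th word is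
`w` and whose `m`-th starting index lies in `{i+1, …, i + Δ_KMP^m(s) − 1}`. -/
theorem kmp_skipping_correct {Alph St : Type*} [Fintype Alph] [Fintype St] {k : ℕ}
    (A : NFA (Alph × Fin k) St) (W : Set (List Alph)) (hW : W.Finite)
    (m : Fin k) (w : List Alph) (hw : w ∈ W)
    (i : ℕ) (hi1 : 1 ≤ i) (hi2 : i ≤ w.length) (j : ℕ) (hj : i ≤ j)
    (s : St) (hs : s ∈ reachStates A m (subword w i j))
    (hdef : (KMPset A m s).Nonempty) :
    ¬ ∃ (ws : Fin k → List Alph) (istart jend : Fin k → ℕ),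
        MatchSet A W ws istart jend ∧ ws m = w ∧
        i + 1 ≤ istart m ∧ istart m ≤ i + ΔKMP A m s - 1 := by
  rintro ⟨ws, istart, jend, ⟨-, what, hacc, hproj⟩, rfl, hlo, hhi⟩
  suffices h : istart m - i ∈ KMPset A m s by
    have := Nat.sInf_le h
    unfold ΔKMP at hhi
    omega
  have hpos : 0 < (ws m).length := by omega
  exact sub_mem_KMPset hi1 (by omega) ((ws m)[0]) hs ⟨what, hacc, hproj m⟩
end
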